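/- arXiv:2502.16408 — 5 statements merged into one kernel-verified Lean document; each statement's English description precedes it below -/
import Mathlib

section
/- Colorable-subset height bound: Let σ, σ' ∈ 𝔽₂^M be syndromes with supp σ' ⊆ supp σ, and suppose no fault index j is adjacent to two distinct check indices of supp σ' (i.e., every column of H has at most one nonzero entry among the rows indexed by supp σ'). Then every correction F for σ satisfies |F| ≥ |supp σ'|; in particular, for correctable σ, h(σ) ≥ |supp σ'|. -/
open Finset

/-- Hamming weight of a fault vector. -/
def hammingWeight {N : ℕ} (F : Fin N → ZMod 2) : ℕ :=
  (univ.filter fun j => F j = 1).card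

/-- Support size of a syndrome. -/
def suppCard {M : ℕ} (σ : Fin M → ZMod 2) : ℕ :=
  (univ.filter fun i => σ i = 1).card

/-- Syndrome height: minimum Hamming weight of a correction for `σ`. -/
noncomputable def synHeight {M N : ℕ} (H : Matrix (Fin M) (Fin N) (ZMod 2))
    (σ : Fin M → ZMod 2) : ℕ :=
  sInf {k | ∃ F, H.mulVec F = σ ∧ hammingWeight F = k}

theorem colorable_subset_height_bound {M N : ℕ} (hM : 0 < M) (hN : 0 < N)
    (H : Matrix (Fin M) (Fin N) (ZMod 2))
    (σ σ' : Fin M → ZMod 2)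
    (hsub : ∀ i, σ' i = 1 → σ i = 1)
    (hcolor : ∀ j : Fin N, ∀ i i' : Fin M, i ≠ i' → σ' i = 1 → σ' i' = 1 →
      ¬(H i j = 1 ∧ H i' j = 1)) :
    (∀ F : Fin N → ZMod 2, H.mulVec F = σ → suppCard σ' ≤ hammingWeight F) ∧
      ((∃ F : Fin N → ZMod 2, H.mulVec F = σ) → suppCard σ' ≤ synHeight H σ) := by
  have key : ∀ F : Fin N → ZMod 2, H.mulVec F = σ → suppCard σ' ≤ hammingWeight F := by
    intro F hF
    have z2 : ∀ a : ZMod 2, a ≠ 0 → a = 1 := by decide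
    have hex : ∀ i, σ' i = 1 → ∃ j, H i j = 1 ∧ F j = 1 := by
      intro i hi
      have h1 : ∑ j, H i j * F j = 1 := by
        have h2 := congrFun hF i
        rw [hsub i hi] at h2
        exact h2
      obtain ⟨j, -, hj⟩ := Finset.exists_ne_zero_of_sum_ne_zero
        (s := univ) (f := fun j => H i j * F j) (by rw [h1]; exact one_ne_zero)
      exact ⟨j, z2 _ (left_ne_zero_of_mul hj), z2 _ (right_ne_zero_of_mul hj)⟩
    unfold suppCard hammingWeight
    refine Finset.card_le_card_of_forall_subsingleton (fun i j => H i j = 1) ?_ ?_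
    · intro i hi
      obtain ⟨j, h1, h2⟩ := hex i (by simpa using hi)
      exact ⟨j, by simpa using h2, h1⟩
    · intro j _ i hi i' hi'
      by_contra hne
      exact hcolor j i i' hne (by simpa using hi.1) (by simpa using hi'.1) ⟨hi.2, hi'.2⟩
  refine ⟨key, ?_⟩
  rintro ⟨F, hF⟩
  have hmem := Nat.sInf_mem (s := {k | ∃ F, H.mulVec F = σ ∧ hammingWeight F = k})
    ⟨_, F, hF, rfl⟩
  obtain ⟨G, hG, hk⟩ := hmem
  unfold synHeight
  rw [← hk]
  exact key G hG
end

section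
/- Sensitivity-count inequality: Let σ ∈ 𝔽₂^M be a syndrome such that every index i ∈ supp σ has at least one adjacent fault, and let c ≥ 1 be an integer such that every column of H has at most c nonzero entries. Then a_c ≤ c·|B_c|, i.e., the number of unsatisfied checks of σ with sensitivity equal to c is at most c times the number of fault indices adjacent to exactly c unsatisfied checks of σ. -/
open Finset

/-- Number of unsatisfied checks of `σ` adjacent to fault `j`. -/
def tFn {M N : ℕ} (H : Matrix (Fin M) (Fin N) (ZMod 2)) (σ : Fin M → ZMod 2)
    (j : Fin N) : ℕ :=
  (univ.filter fun i => σ i = 1 ∧ H i j = 1).card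

/-- Sensitivity of check `i`: max of `tFn` over faults adjacent to `i`. -/
def sen {M N : ℕ} (H : Matrix (Fin M) (Fin N) (ZMod 2)) (σ : Fin M → ZMod 2)
    (i : Fin M) : ℕ :=
  (univ.filter fun j => H i j = 1).sup (tFn H σ)

/-- Number of unsatisfied checks of `σ` with sensitivity `l`. -/
def aCount {M N : ℕ} (H : Matrix (Fin M) (Fin N) (ZMod 2)) (σ : Fin M → ZMod 2)
    (l : ℕ) : ℕ :=
  (univ.filter fun i => σ i = 1 ∧ sen H σ i = l).card

/-- Number of fault indices adjacent to exactly `c` unsatisfied checks of `σ`. -/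
def bCount {M N : ℕ} (H : Matrix (Fin M) (Fin N) (ZMod 2)) (σ : Fin M → ZMod 2)
    (c : ℕ) : ℕ :=
  (univ.filter fun j => tFn H σ j = c).card

theorem sensitivity_count_inequality {M N : ℕ} (hM : 0 < M) (hN : 0 < N)
    (H : Matrix (Fin M) (Fin N) (ZMod 2)) (c : ℕ) (hc : 1 ≤ c)
    (hcol : ∀ j, (univ.filter fun i => H i j = 1).card ≤ c)
    (σ : Fin M → ZMod 2)
    (hadj : ∀ i, σ i = 1 → ∃ j, H i j = 1) :
    aCount H σ c ≤ c * bCount H σ c := by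
  have hsub : (univ.filter fun i => σ i = 1 ∧ sen H σ i = c) ⊆
      (univ.filter fun j => tFn H σ j = c).biUnion
        (fun j => univ.filter fun i => σ i = 1 ∧ H i j = 1) := by
    intro i hi
    obtain ⟨h1, h2⟩ := (mem_filter.mp hi).2
    obtain ⟨j0, hj0⟩ := hadj i h1
    have hne : (univ.filter fun j => H i j = 1).Nonempty :=
      ⟨j0, mem_filter.mpr ⟨mem_univ _, hj0⟩⟩
    obtain ⟨j, hj, hjs⟩ := Finset.exists_mem_eq_sup _ hne (tFn H σ)
    refine mem_biUnion.mpr ⟨j, mem_filter.mpr ⟨mem_univ _, ?_⟩,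
      mem_filter.mpr ⟨mem_univ _, h1, (mem_filter.mp hj).2⟩⟩
    rw [← hjs]
    exact h2
  have hb := Finset.card_biUnion_le_card_mul (univ.filter fun j => tFn H σ j = c)
    (fun j => univ.filter fun i => σ i = 1 ∧ H i j = 1) c
    (fun j hj => le_of_eq (mem_filter.mp hj).2)
  have h := (card_le_card hsub).trans hb
  rw [mul_comm]
  exact h
end

section
/- Minimum-weight logical operators are indecomposable: Suppose L ∈ 𝔽₂^N is a logical operator of minimum Hamming weight, i.e., H·L = 0, A·L ≠ 0, and |L| ≤ |F| for every F with H·F = 0 and A·F ≠ 0. Then for every G ∈ 𝔽₂^N with supp G ⊆ supp L and H·G = 0, either G = 0 or G = L. -/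
open Finset

theorem eq_of_weight_le {N : ℕ} (F L : Fin N → ZMod 2) (h : ∀ j, F j = 1 → L j = 1)
    (hw : hammingWeight L ≤ hammingWeight F) : F = L := by
  have hs : (univ.filter fun j => F j = 1) = (univ.filter fun j => L j = 1) := by
    apply Finset.eq_of_subset_of_card_le
    · intro j hj
      simp only [mem_filter, mem_univ, true_and] at hj ⊢
      exact h j hj
    · exact hw
  funext j
  have hj := congrArg (fun s => j ∈ s) hs
  simp only [mem_filter, mem_univ, true_and, eq_iff_iff] at hj
  revert hj
  generalize F j = a
  generalize L j = b
  revert a b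
  decide

theorem min_weight_logicals_indecomposable {M N K : ℕ}
    (hM : 0 < M) (hN : 0 < N) (hK : 0 < K)
    (H : Matrix (Fin M) (Fin N) (ZMod 2)) (A : Matrix (Fin K) (Fin N) (ZMod 2))
    (L : Fin N → ZMod 2)
    (hHL : H.mulVec L = 0) (hAL : A.mulVec L ≠ 0)
    (hmin : ∀ F : Fin N → ZMod 2, H.mulVec F = 0 → A.mulVec F ≠ 0 →
      hammingWeight L ≤ hammingWeight F) :
    ∀ G : Fin N → ZMod 2, (∀ j, G j = 1 → L j = 1) → H.mulVec G = 0 →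
      G = 0 ∨ G = L := by
  intro G hG hHG
  by_cases hAG : A.mulVec G = 0
  · left
    have h : L - G = L := by
      apply eq_of_weight_le
      · intro j
        have := hG j
        rw [Pi.sub_apply]
        revert this
        generalize G j = a
        generalize L j = b
        revert a b
        decide
      · apply hmin
        · rw [Matrix.mulVec_sub, hHL, hHG, sub_zero]
        · rw [Matrix.mulVec_sub, hAG, sub_zero]
          exact hAL
    exact sub_eq_self.mp h
  · right
    exact eq_of_weight_le G L hG (hmin G hHG hAG)
end

section
/- Logical-operator enclosure constraint: Let L, F ∈ 𝔽₂^N with H·L = 0 and supp F ⊆ supp L. Then the syndrome H·F is correctable and h(H·F) + |F| ≤ |L|. In particular, if d is the minimum Hamming weight of a logical operator, a fault vector F with h(H·F) + |F| > d cannot satisfy supp F ⊆ supp L for any weight-d logical operator L. -/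
open Finset

theorem enclosure_aux {M N : ℕ} (H : Matrix (Fin M) (Fin N) (ZMod 2))
    (L F : Fin N → ZMod 2) (hHL : H.mulVec L = 0)
    (hsub : ∀ j, F j = 1 → L j = 1) :
    synHeight H (H.mulVec F) + hammingWeight F ≤ hammingWeight L := by
  have h1 : synHeight H (H.mulVec F) ≤ hammingWeight (L - F) := by
    apply Nat.sInf_le
    refine ⟨L - F, ?_, rfl⟩
    rw [Matrix.mulVec_sub, hHL, zero_sub]
    funext i
    exact ZMod.neg_eq_self_mod_two _
  have h2 : hammingWeight (L - F) + hammingWeight F = hammingWeight L := by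
    unfold hammingWeight
    rw [← Finset.card_union_of_disjoint]
    · congr 1
      ext j
      have := hsub j
      simp only [Finset.mem_union, Finset.mem_filter, Finset.mem_univ, true_and, Pi.sub_apply]
      generalize F j = a at *
      generalize L j = b at *
      revert a b
      decide
    · rw [Finset.disjoint_filter]
      intro j _
      have := hsub j
      simp only [Pi.sub_apply]
      generalize F j = a at *
      generalize L j = b at *
      revert a b
      decide
  omega

theorem logical_operator_enclosure_constraint {M N K : ℕ}
    (hM : 0 < M) (hN : 0 < N) (hK : 0 < K)
    (H : Matrix (Fin M) (Fin N) (ZMod 2)) (A : Matrix (Fin K) (Fin N) (ZMod 2))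
    (L F : Fin N → ZMod 2)
    (hHL : H.mulVec L = 0)
    (hsub : ∀ j, F j = 1 → L j = 1) :
    ((∃ G : Fin N → ZMod 2, H.mulVec G = H.mulVec F) ∧
      synHeight H (H.mulVec F) + hammingWeight F ≤ hammingWeight L) ∧
    (∀ d : ℕ,
      (∃ L₀ : Fin N → ZMod 2, H.mulVec L₀ = 0 ∧ A.mulVec L₀ ≠ 0 ∧
          hammingWeight L₀ = d) →
      (∀ L₁ : Fin N → ZMod 2, H.mulVec L₁ = 0 → A.mulVec L₁ ≠ 0 →
          d ≤ hammingWeight L₁) →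
      ∀ F' L' : Fin N → ZMod 2,
        synHeight H (H.mulVec F') + hammingWeight F' > d →
        H.mulVec L' = 0 → A.mulVec L' ≠ 0 → hammingWeight L' = d →
        ¬(∀ j, F' j = 1 → L' j = 1)) := by
  refine ⟨⟨⟨F, rfl⟩, enclosure_aux H L F hHL hsub⟩, ?_⟩
  intro d _ _ F' L' hd hL _ hw hs
  have := enclosure_aux H L' F' hL hs
  omega
end

section
/- Pruning bound from a known correction: Suppose the set of logical operators {F ∈ 𝔽₂^N : H·F = 0 and A·F ≠ 0} is nonempty and let d be its minimum Hamming weight. Let F, F', F̂ ∈ 𝔽₂^N satisfy supp F ⊆ supp F', H·F' = H·F̂, and A·F' ≠ A·F̂. Then |F'| + |F̂| ≥ d + 2·|supp F ∩ supp F̂|. -/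
open Finset

theorem pruning_bound_from_known_correction {M N K : ℕ}
    (hM : 0 < M) (hN : 0 < N) (hK : 0 < K)
    (H : Matrix (Fin M) (Fin N) (ZMod 2)) (A : Matrix (Fin K) (Fin N) (ZMod 2))
    (hne : ∃ L : Fin N → ZMod 2, H.mulVec L = 0 ∧ A.mulVec L ≠ 0)
    (F F' Fhat : Fin N → ZMod 2)
    (hsub : ∀ j, F j = 1 → F' j = 1)
    (hsyn : H.mulVec F' = H.mulVec Fhat)
    (hlog : A.mulVec F' ≠ A.mulVec Fhat) :
    sInf {k | ∃ L : Fin N → ZMod 2,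
        H.mulVec L = 0 ∧ A.mulVec L ≠ 0 ∧ hammingWeight L = k} +
      2 * ((univ.filter fun j => F j = 1) ∩ (univ.filter fun j => Fhat j = 1)).card ≤
    hammingWeight F' + hammingWeight Fhat := by
  have h1 : sInf {k | ∃ L : Fin N → ZMod 2,
        H.mulVec L = 0 ∧ A.mulVec L ≠ 0 ∧ hammingWeight L = k} ≤ hammingWeight (F' - Fhat) := by
    apply Nat.sInf_le
    refine ⟨F' - Fhat, ?_, ?_, rfl⟩
    · rw [Matrix.mulVec_sub, hsyn, sub_self]
    · rw [Matrix.mulVec_sub]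
      exact sub_ne_zero.mpr hlog
  have h2 : hammingWeight (F' - Fhat) +
      2 * ((univ.filter fun j => F j = 1) ∩ (univ.filter fun j => Fhat j = 1)).card ≤
      hammingWeight F' + hammingWeight Fhat := by
    unfold hammingWeight
    rw [← Finset.filter_and]
    simp only [Finset.card_filter, Finset.mul_sum]
    rw [← Finset.sum_add_distrib, ← Finset.sum_add_distrib]
    apply Finset.sum_le_sum
    intro j _
    have key : ∀ a b c : ZMod 2, (a = 1 → b = 1) →
        (if b - c = 1 then 1 else 0) + 2 * (if a = 1 ∧ c = 1 then 1 else 0) ≤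
        (if b = 1 then 1 else 0) + (if c = 1 then 1 else 0 : ℕ) := by decide
    exact key (F j) (F' j) (Fhat j) (hsub j)
  omega
end
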